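/- arXiv:1708.09378 — 2 statements merged into one kernel-verified Lean document; each statement's English description precedes it below -/
import Mathlib

section
/- Fix integers r ≥ 0, g ≥ 1 and nonincreasing (r+1)-tuples λ^1, ρ^g of integers. The poset PT(λ^1, ρ^g) is finite, and for every pontableau P ∈ PT(λ^1, ρ^g) the combinatorial value μ(P) equals the Möbius function μ_{PT(λ^1,ρ^g)}(P); equivalently, for every P ∈ PT(λ^1, ρ^g), Σ_{P̄ ∈ PT(λ^1,ρ^g), P̄ ⊇ P} μ(P̄) = 1. -/
namespace Pont

/-- The set of boxes of a nonincreasing `(r+1)`-tuple `l`: all `(x,y)` with `x < l y`. -/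
def boxes (r : ℕ) (l : Fin (r + 1) → ℤ) : Set (ℤ × Fin (r + 1)) := {b | b.1 < l b.2}

/-- `b` is an inward corner of `l`: a minimal box not in `l` for the componentwise order. -/
def IsInwardCorner (r : ℕ) (l : Fin (r + 1) → ℤ) (b : ℤ × Fin (r + 1)) : Prop :=
  b ∉ boxes r l ∧ ∀ b' : ℤ × Fin (r + 1), b' ∉ boxes r l → b'.1 ≤ b.1 → b'.2 ≤ b.2 → b' = b

/-- `l ∪ b`: the tuple obtained by increasing `l` by `1` in the row of `b`. -/
def addBox (r : ℕ) (l : Fin (r + 1) → ℤ) (b : ℤ × Fin (r + 1)) : Fin (r + 1) → ℤ :=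
  fun y => if y = b.2 then l y + 1 else l y

/-- Raw data of a pontableau sequence `(λ¹, ρ¹, …, λᵍ, ρᵍ)`; `lam n`, `rho n` are only
meaningful for `1 ≤ n ≤ g`, and are normalised to `0` elsewhere. -/
structure PontSeq (r : ℕ) where
  lam : ℕ → Fin (r + 1) → ℤ
  rho : ℕ → Fin (r + 1) → ℤ

/-- The conditions defining a pontableau sequence. -/
def ValidPont (r g : ℕ) (P : PontSeq r) : Prop :=
  (∀ n, 1 ≤ n → n ≤ g → Antitone (P.lam n) ∧ Antitone (P.rho n)) ∧
  (∀ n, 1 ≤ n → n + 1 ≤ g → boxes r (P.lam (n + 1)) ⊆ boxes r (P.rho n)) ∧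
  (∀ n, 1 ≤ n → n ≤ g →
    boxes r (P.rho n) ⊆ boxes r (P.lam n) ∨
      ∃ b, IsInwardCorner r (P.lam n) b ∧
        boxes r (P.rho n) ⊆ boxes r (addBox r (P.lam n) b)) ∧
  (∀ n, n = 0 ∨ g < n → P.lam n = 0 ∧ P.rho n = 0)

/-- `PT(λ¹, ρᵍ)`: pontableaux with prescribed first tuple `λ¹` and last tuple `ρᵍ`. -/
def PT (r g : ℕ) (l1 rg : Fin (r + 1) → ℤ) : Set (PontSeq r) :=
  {P | ValidPont r g P ∧ P.lam 1 = l1 ∧ P.rho g = rg}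

/-- The boxes carrying the left-removal `−n`, namely `ρ^{n−1} ∖ λ^n`. -/
def lrs (r : ℕ) (P : PontSeq r) (n : ℕ) : Set (ℤ × Fin (r + 1)) :=
  boxes r (P.rho (n - 1)) \ boxes r (P.lam n)

open Classical in
/-- `μ(P)`: zero if some left-removal `−n` occurs in two (horizontally or vertically)
adjacent boxes, and otherwise `(−1)^L` where `L` is the total number of left-removals. -/
noncomputable def mu (r g : ℕ) (P : PontSeq r) : ℤ :=
  if ∃ n, 2 ≤ n ∧ n ≤ g ∧ ∃ b ∈ lrs r P n,
      ((b.1 + 1, b.2) ∈ lrs r P n ∨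
        ∃ y' : Fin (r + 1), (y' : ℕ) = (b.2 : ℕ) + 1 ∧ (b.1, y') ∈ lrs r P n)
  then 0
  else (-1) ^ ∑ n ∈ Finset.Icc 2 g, (lrs r P n).ncard

open Classical in
/-- `χ(P)`: `1` if every augmentation `n ∈ {1,…,g}` occurs in some box (i.e. each
`ρ^n ∖ λ^n` is nonempty), and `0` otherwise. -/
noncomputable def chi (r g : ℕ) (P : PontSeq r) : ℤ :=
  if ∀ n, 1 ≤ n → n ≤ g → (boxes r (P.rho n) \ boxes r (P.lam n)).Nonempty then 1 else 0


end Pont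

namespace Pont

lemma boxes_subset_iff {r : ℕ} {a b : Fin (r + 1) → ℤ} : boxes r a ⊆ boxes r b ↔ a ≤ b := by
  constructor
  · intro h y
    by_contra! hlt
    have : ((b y, y) : ℤ × Fin (r + 1)) ∈ boxes r b := h hlt
    exact lt_irrefl (b y) this
  · intro h x hx
    exact lt_of_lt_of_le hx (h x.2)

/-- The relation between `λ^n` and `ρ^n` required of a pontableau. -/
def Step (r : ℕ) (l m : Fin (r + 1) → ℤ) : Prop :=
  boxes r m ⊆ boxes r l ∨ ∃ b, IsInwardCorner r l b ∧ boxes r m ⊆ boxes r (addBox r l b)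

lemma Step.le_add_one {r : ℕ} {l m : Fin (r + 1) → ℤ} (h : Step r l m) (y : Fin (r + 1)) :
    m y ≤ l y + 1 := by
  rcases h with h | ⟨b, -, h⟩
  · have := boxes_subset_iff.1 h y
    lia
  · have := boxes_subset_iff.1 h y
    simp only [addBox] at this
    split_ifs at this <;> lia

/-- The step condition is inherited when `l` grows and `m` shrinks. -/
lemma Step.mono {r : ℕ} {l m l' m' : Fin (r + 1) → ℤ} (h : Step r l m) (hl : l ≤ l')
    (hm : m' ≤ m) : Step r l' m' := by
  rcases h with h | ⟨b, ⟨hb, hmin⟩, h⟩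
  · exact Or.inl (boxes_subset_iff.2 (hm.trans ((boxes_subset_iff.1 h).trans hl)))
  · have h := hm.trans (boxes_subset_iff.1 h)
    by_cases hbl : b ∈ boxes r l'
    · refine Or.inl (boxes_subset_iff.2 fun y => ?_)
      have h1 := h y
      have h2 := hl y
      simp only [addBox] at h1
      split_ifs at h1 with hy
      · have h3 : b.1 < l' b.2 := hbl
        have h4 : ¬ b.1 < l b.2 := hb
        subst hy
        have h5 : b.1 = l b.2 := by
          have := hmin (l b.2, b.2) (lt_irrefl (l b.2)) (not_lt.1 h4) le_rfl
          rw [← this]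
        lia
      · lia
    · refine Or.inr ⟨b, ⟨hbl, fun b' hb' => hmin b' fun hc => ?_⟩, boxes_subset_iff.2 fun y => ?_⟩
      · exact hb' (boxes_subset_iff.2 hl hc)
      · have h1 := h y
        have h2 := hl y
        simp only [addBox] at h1 ⊢
        split_ifs at h1 ⊢ <;> lia

/-- Some two horizontally or vertically adjacent boxes lie in `s`. -/
def HasAdjacent (r : ℕ) (s : Set (ℤ × Fin (r + 1))) : Prop :=
  ∃ b ∈ s, (b.1 + 1, b.2) ∈ s ∨ ∃ y' : Fin (r + 1), (y' : ℕ) = (b.2 : ℕ) + 1 ∧ (b.1, y') ∈ s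

open Classical in
/-- The contribution of a single skew shape to `mu`. -/
noncomputable def weight (r : ℕ) (x y : Fin (r + 1) → ℤ) : ℤ :=
  if ¬ HasAdjacent r (boxes r y \ boxes r x) then (-1) ^ (boxes r y \ boxes r x).ncard else 0

lemma mu_eq_prod (r k : ℕ) (Q : PontSeq r) :
    mu r (k + 1) Q = ∏ i : Fin k, weight r (Q.lam (i + 2)) (Q.rho (i + 1)) := by
  classical
  have hsum : ∑ n ∈ Finset.Icc 2 (k + 1), (lrs r Q n).ncard
      = ∑ i : Fin k, (lrs r Q (i + 2)).ncard := by
    rw [Fin.sum_univ_eq_sum_range (fun i => (lrs r Q (i + 2)).ncard),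
      ← Finset.Ico_add_one_right_eq_Icc, Finset.sum_Ico_eq_sum_range]
    exact Finset.sum_congr (by congr 1) fun i _ => by rw [add_comm 2 i]
  have hiff : (∃ n, 2 ≤ n ∧ n ≤ k + 1 ∧ HasAdjacent r (lrs r Q n)) ↔
      ¬ ∀ i ∈ (Finset.univ : Finset (Fin k)),
        ¬ HasAdjacent r (boxes r (Q.rho (i + 1)) \ boxes r (Q.lam (i + 2))) := by
    push Not
    constructor
    · rintro ⟨n, h2, hn, h⟩
      refine ⟨⟨n - 2, by lia⟩, Finset.mem_univ _, ?_⟩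
      obtain ⟨m, rfl⟩ := Nat.exists_eq_add_of_le' h2
      exact h
    · rintro ⟨i, -, h⟩
      exact ⟨i + 2, by lia, by lia, h⟩
  unfold weight
  rw [Finset.prod_ite_zero, Finset.prod_pow_eq_pow_sum]
  unfold mu
  rw [hsum]
  by_cases h : ∃ n, 2 ≤ n ∧ n ≤ k + 1 ∧ HasAdjacent r (lrs r Q n)
  · rw [if_neg (hiff.1 h)]
    exact if_pos h
  · rw [if_pos (not_not.1 (mt hiff.2 h))]
    exact if_neg h

/-- Remove one box from the end of each row in `S`. -/
def shrink {r : ℕ} (y : Fin (r + 1) → ℤ) (S : Finset (Fin (r + 1))) : Fin (r + 1) → ℤ :=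
  fun j => if j ∈ S then y j - 1 else y j

/-- The rows of `y` ending in a removable box outside `l`. -/
def cornerRows {r : ℕ} (l y : Fin (r + 1) → ℤ) : Finset (Fin (r + 1)) :=
  {j | l j < y j ∧ ∀ k, j < k → y k < y j}

lemma boxes_diff_shrink {r : ℕ} (y : Fin (r + 1) → ℤ) (S : Finset (Fin (r + 1))) :
    boxes r y \ boxes r (shrink y S) = (fun j => (y j - 1, j)) '' (S : Set (Fin (r + 1))) := by
  ext ⟨a, j⟩
  simp only [boxes, shrink, Set.mem_sdiff, Set.mem_ofPred_eq, Set.mem_image, Finset.mem_coe,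
    Prod.mk.injEq]
  constructor
  · rintro ⟨h1, h2⟩
    split_ifs at h2 with hj
    · exact ⟨j, hj, by lia, rfl⟩
    · exact absurd h1 h2
  · rintro ⟨j', hj, h, rfl⟩
    rw [if_pos hj]
    lia

lemma weight_shrink {r : ℕ} {l y : Fin (r + 1) → ℤ} {S : Finset (Fin (r + 1))}
    (hS : S ⊆ cornerRows l y) : weight r (shrink y S) y = (-1) ^ S.card := by
  unfold weight
  rw [boxes_diff_shrink, if_pos, Set.ncard_image_of_injective _ fun i j h => (Prod.ext_iff.1 h).2,
    Set.ncard_coe_finset]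
  rintro ⟨b, ⟨j, hj, rfl⟩, ⟨j', hj', h⟩ | ⟨y', hy', j', hj', h⟩⟩
  · simp only [Prod.mk.injEq] at h
    obtain ⟨h, rfl⟩ := h
    lia
  · simp only [Prod.mk.injEq] at h hy'
    obtain ⟨h, rfl⟩ := h
    have := (Finset.mem_filter.1 (hS hj)).2.2 j' (Fin.lt_def.2 (by lia))
    lia

lemma antitone_shrink {r : ℕ} {l y : Fin (r + 1) → ℤ} (hy : Antitone y)
    {S : Finset (Fin (r + 1))} (hS : S ⊆ cornerRows l y) : Antitone (shrink y S) := by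
  intro i j hij
  rcases hij.eq_or_lt with rfl | hlt
  · exact le_rfl
  have h1 := hy hij
  simp only [shrink]
  split_ifs with hj hi hi
  · lia
  · lia
  · have := (Finset.mem_filter.1 (hS hi)).2.2 j hlt
    lia
  · exact h1

lemma eq_shrink_of_not_hasAdjacent {r : ℕ} {l x y : Fin (r + 1) → ℤ} (hx : Antitone x)
    (hy : Antitone y) (hlx : l ≤ x) (hxy : x ≤ y)
    (h : ¬ HasAdjacent r (boxes r y \ boxes r x)) :
    ∃ S ⊆ cornerRows l y, shrink y S = x := by
  have key : ∀ j, x j < y j → x j = y j - 1 := by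
    intro j hj
    by_contra hne
    refine h ⟨(x j, j), ⟨hj, lt_irrefl (x j)⟩, Or.inl ⟨?_, ?_⟩⟩
    · change x j + 1 < y j
      lia
    · change ¬ x j + 1 < x j
      lia
  refine ⟨({j | x j < y j} : Finset _), fun j hj => ?_, ?_⟩
  · have hj : x j < y j := (Finset.mem_filter.1 hj).2
    refine Finset.mem_filter.2 ⟨Finset.mem_univ _, (hlx j).trans_lt hj, fun k hk => ?_⟩
    by_contra! hle
    have hjk := Fin.lt_def.1 hk
    have hk' := k.isLt
    let j' : Fin (r + 1) := ⟨j + 1, by lia⟩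
    have h1 : y k ≤ y j' := hy (Fin.le_def.2 (by simp only [j']; lia))
    have h2 : x j' ≤ x j := hx (Fin.le_def.2 (by simp only [j']; lia))
    refine h ⟨(x j, j), ⟨hj, lt_irrefl (x j)⟩, Or.inr ⟨j', rfl, ?_, ?_⟩⟩
    · change x j < y j'
      lia
    · change ¬ x j < x j'
      lia
  · funext j
    have h1 := hxy j
    have h2 := key j
    simp only [shrink, Finset.mem_filter, Finset.mem_univ, true_and]
    split_ifs <;> lia

lemma cornerRows_eq_empty_iff {r : ℕ} {l y : Fin (r + 1) → ℤ} (hl : Antitone l)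
    (hly : l ≤ y) : cornerRows l y = ∅ ↔ y = l := by
  constructor
  · intro h
    by_contra hne
    have hne' : ({j | l j < y j} : Finset (Fin (r + 1))).Nonempty := by
      obtain ⟨j, hj⟩ := Function.ne_iff.1 hne
      exact ⟨j, Finset.mem_filter.2 ⟨Finset.mem_univ _, lt_of_le_of_ne (hly j) (Ne.symm hj)⟩⟩
    obtain ⟨j, hj, hmax⟩ := Finset.exists_max_image _ id hne'
    have hj := (Finset.mem_filter.1 hj).2
    have : j ∈ cornerRows l y := by
      refine Finset.mem_filter.2 ⟨Finset.mem_univ _, hj, fun k hk => ?_⟩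
      have h1 : ¬ l k < y k := fun hc =>
        absurd (hmax k (Finset.mem_filter.2 ⟨Finset.mem_univ _, hc⟩)) (not_le.2 hk)
      have h2 := hl hk.le
      lia
    rw [h] at this
    exact absurd this (Finset.notMem_empty _)
  · rintro rfl
    simp [cornerRows]

open Classical in
/-- The antitone tuples between `l` and `m`. -/
noncomputable def tuples {r : ℕ} (l m : Fin (r + 1) → ℤ) : Finset (Fin (r + 1) → ℤ) :=
  {x ∈ Finset.Icc l m | Antitone x}

lemma mem_tuples {r : ℕ} {l m x : Fin (r + 1) → ℤ} :
    x ∈ tuples l m ↔ (l ≤ x ∧ x ≤ m) ∧ Antitone x := by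
  simp [tuples]

lemma sum_weight {r : ℕ} {l y : Fin (r + 1) → ℤ} (hl : Antitone l) (hy : Antitone y)
    (hly : l ≤ y) : ∑ x ∈ tuples l y, weight r x y = if y = l then 1 else 0 := by
  have hsum : ∑ S ∈ (cornerRows l y).powerset, (-1 : ℤ) ^ S.card
      = ∑ x ∈ tuples l y, weight r x y := by
    refine Finset.sum_of_injOn (shrink y) ?_ ?_ ?_ ?_
    · intro S _ T _ hST
      ext j
      have := congrFun hST j
      simp only [shrink] at this
      split_ifs at this with h1 h2 h2
      · simp [h1, h2]
      · lia
      · lia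
      · simp [h1, h2]
    · intro S hS
      have hS : S ⊆ cornerRows l y := Finset.mem_powerset.1 hS
      refine mem_tuples.2 ⟨⟨fun j => ?_, fun j => ?_⟩, antitone_shrink hy hS⟩
      · have h1 := hly j
        simp only [shrink]
        split_ifs with hj
        · have := (Finset.mem_filter.1 (hS hj)).2.1
          lia
        · exact h1
      · simp only [shrink]
        split_ifs <;> lia
    · intro x hx hne
      obtain ⟨⟨h1, h2⟩, h3⟩ := mem_tuples.1 hx
      refine if_neg (not_not.2 ?_)
      by_contra h
      obtain ⟨S, hS, hSx⟩ := eq_shrink_of_not_hasAdjacent h3 hy h1 h2 h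
      exact hne ⟨S, Finset.mem_coe.2 (Finset.mem_powerset.2 hS), hSx⟩
    · intro S hS
      exact (weight_shrink (Finset.mem_powerset.1 hS)).symm
  rw [← hsum, Finset.sum_powerset_neg_one_pow_card]
  simp only [cornerRows_eq_empty_iff hl hly]

open Classical in
/-- The pairs of antitone tuples `x ≤ y` between `l` and `m`. -/
noncomputable def nestedPairs {r : ℕ} (l m : Fin (r + 1) → ℤ) :
    Finset ((Fin (r + 1) → ℤ) × (Fin (r + 1) → ℤ)) :=
  {p ∈ tuples l m ×ˢ tuples l m | p.1 ≤ p.2}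

lemma mem_nestedPairs {r : ℕ} {l m : Fin (r + 1) → ℤ}
    {p : (Fin (r + 1) → ℤ) × (Fin (r + 1) → ℤ)} :
    p ∈ nestedPairs l m ↔ l ≤ p.1 ∧ p.1 ≤ p.2 ∧ p.2 ≤ m ∧ Antitone p.1 ∧ Antitone p.2 := by
  simp only [nestedPairs, Finset.mem_filter, Finset.mem_product, mem_tuples]
  constructor
  · tauto
  · rintro ⟨h1, h2, h3, h4, h5⟩
    exact ⟨⟨⟨⟨h1, h2.trans h3⟩, h4⟩, ⟨h1.trans h2, h3⟩, h5⟩, h2⟩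

lemma sum_weight_nestedPairs {r : ℕ} {l m : Fin (r + 1) → ℤ} (hl : Antitone l) (hlm : l ≤ m) :
    ∑ p ∈ nestedPairs l m, weight r p.1 p.2 = 1 := by
  rw [Finset.sum_finset_product_right (nestedPairs l m) (tuples l m) (fun y => tuples l y)]
  · rw [Finset.sum_congr rfl fun y hy =>
      sum_weight hl (mem_tuples.1 hy).2 (mem_tuples.1 hy).1.1]
    rw [Finset.sum_ite_eq', if_pos (mem_tuples.2 ⟨⟨le_rfl, hlm⟩, hl⟩)]
  · intro p
    rw [mem_nestedPairs, mem_tuples, mem_tuples]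
    constructor
    · rintro ⟨h1, h2, h3, h4, h5⟩
      exact ⟨⟨⟨h1.trans h2, h3⟩, h5⟩, ⟨h1, h2⟩, h4⟩
    · tauto

lemma PontSeq.ext' {r : ℕ} {P Q : PontSeq r} (h1 : ∀ n, P.lam n = Q.lam n)
    (h2 : ∀ n, P.rho n = Q.rho n) : P = Q := by
  cases P
  cases Q
  congr
  · exact funext h1
  · exact funext h2

lemma upper_bound {r g : ℕ} {P : PontSeq r} (hP : ValidPont r g P) (y : Fin (r + 1)) (n : ℕ)
    (hn : n + 1 ≤ g) : P.lam (n + 1) y ≤ P.lam 1 y + n ∧ P.rho (n + 1) y ≤ P.lam 1 y + n + 1 := by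
  have hstep (m) (h1 : 1 ≤ m) (h2 : m ≤ g) : Step r (P.lam m) (P.rho m) := hP.2.2.1 m h1 h2
  induction n with
  | zero =>
    have := (hstep 1 le_rfl hn).le_add_one y
    simp only [zero_add, Nat.cast_zero, add_zero]
    lia
  | succ n ih =>
    have h1 := ih (by lia)
    have h2 := boxes_subset_iff.1 (hP.2.1 (n + 1) (by lia) hn) y
    have h3 := (hstep (n + 1 + 1) (by lia) hn).le_add_one y
    push_cast
    lia

lemma lower_bound {r g : ℕ} {P : PontSeq r} (hP : ValidPont r g P) (y : Fin (r + 1)) (n : ℕ)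
    (hn : n + 1 ≤ g) : P.rho g y - n ≤ P.rho (g - n) y ∧ P.rho g y - n - 1 ≤ P.lam (g - n) y := by
  have hstep (m) (h1 : 1 ≤ m) (h2 : m ≤ g) : Step r (P.lam m) (P.rho m) := hP.2.2.1 m h1 h2
  induction n with
  | zero =>
    have := (hstep g hn le_rfl).le_add_one y
    simp only [Nat.sub_zero, Nat.cast_zero]
    lia
  | succ n ih =>
    have h1 := ih (by lia)
    have h2 := boxes_subset_iff.1 (hP.2.1 (g - (n + 1)) (by lia) (by lia)) y
    rw [show g - (n + 1) + 1 = g - n by lia] at h2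
    have h3 := (hstep (g - (n + 1)) (by lia) (by lia)).le_add_one y
    push_cast
    lia

lemma finite_PT (r g : ℕ) (l1 rg : Fin (r + 1) → ℤ) : (PT r g l1 rg).Finite := by
  classical
  let B : Fin (r + 1) → ℤ := fun y => |l1 y| + |rg y| + g + 1
  have hB0 (y) : 0 ≤ B y := by positivity
  refine Set.Finite.of_finite_image
    (f := fun P : PontSeq r => fun n : Fin (g + 1) => (P.lam n, P.rho n)) ?_ ?_
  · refine (Set.finite_Icc (fun _ : Fin (g + 1) => (-B, -B)) (fun _ => (B, B))).subset ?_
    rintro _ ⟨P, ⟨hP, rfl, rfl⟩, rfl⟩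
    have key (n : ℕ) (hn : n ≤ g) (y) :
        -B y ≤ P.lam n y ∧ P.lam n y ≤ B y ∧ -B y ≤ P.rho n y ∧ P.rho n y ≤ B y := by
      rcases Nat.eq_zero_or_pos n with rfl | hpos
      · have h := hP.2.2.2 0 (Or.inl rfl)
        have := hB0 y
        simp only [h.1, h.2, Pi.zero_apply]
        lia
      · have h1 := upper_bound hP y (n - 1) (by lia)
        have h2 := lower_bound hP y (g - n) (by lia)
        rw [Nat.sub_add_cancel hpos] at h1
        rw [Nat.sub_sub_self hn] at h2
        have h3 := le_abs_self (P.lam 1 y)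
        have h4 := neg_abs_le (P.rho g y)
        have h5 := abs_nonneg (P.lam 1 y)
        have h6 := abs_nonneg (P.rho g y)
        simp only [B]
        lia
    exact ⟨fun n => ⟨fun y => (key n (by lia) y).1, fun y => (key n (by lia) y).2.2.1⟩,
      fun n => ⟨fun y => (key n (by lia) y).2.1, fun y => (key n (by lia) y).2.2.2⟩⟩
  · intro P hP Q hQ h
    have key (n : ℕ) : P.lam n = Q.lam n ∧ P.rho n = Q.rho n := by
      by_cases hn : n ≤ g
      · exact Prod.ext_iff.1 (congrFun h ⟨n, by lia⟩)
      · have h1 := hP.1.2.2.2 n (Or.inr (by lia))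
        have h2 := hQ.1.2.2.2 n (Or.inr (by lia))
        exact ⟨h1.1.trans h2.1.symm, h1.2.trans h2.2.symm⟩
    exact PontSeq.ext' (fun n => (key n).1) fun n => (key n).2

/-- The pontableaux above `P`. -/
def above (r g : ℕ) (l1 rg : Fin (r + 1) → ℤ) (P : PontSeq r) : Set (PontSeq r) :=
  {Q | Q ∈ PT r g l1 rg ∧ ∀ n, 1 ≤ n → n + 1 ≤ g →
    boxes r (P.lam (n + 1)) ⊆ boxes r (Q.lam (n + 1)) ∧
    boxes r (Q.lam (n + 1)) ⊆ boxes r (Q.rho n) ∧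
    boxes r (Q.rho n) ⊆ boxes r (P.rho n)}

/-- Replace the pairs `(λ^{n+1}, ρ^n)` of `P` by those listed in `p`. -/
def splice {r k : ℕ} (P : PontSeq r)
    (p : Fin k → (Fin (r + 1) → ℤ) × (Fin (r + 1) → ℤ)) : PontSeq r where
  lam n := if h : 2 ≤ n ∧ n ≤ k + 1 then (p ⟨n - 2, by lia⟩).1 else P.lam n
  rho n := if h : 1 ≤ n ∧ n ≤ k then (p ⟨n - 1, by lia⟩).2 else P.rho n

lemma splice_lam {r k : ℕ} (P : PontSeq r)
    (p : Fin k → (Fin (r + 1) → ℤ) × (Fin (r + 1) → ℤ)) (i : Fin k) :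
    (splice P p).lam (i + 2) = (p i).1 := by
  have : 2 ≤ (i : ℕ) + 2 ∧ (i : ℕ) + 2 ≤ k + 1 := by lia
  simp [splice, this]

lemma splice_rho {r k : ℕ} (P : PontSeq r)
    (p : Fin k → (Fin (r + 1) → ℤ) × (Fin (r + 1) → ℤ)) (i : Fin k) :
    (splice P p).rho (i + 1) = (p i).2 := by
  have : 1 ≤ (i : ℕ) + 1 ∧ (i : ℕ) + 1 ≤ k := by lia
  simp [splice, this]

lemma splice_mem_above {r k : ℕ} {l1 rg : Fin (r + 1) → ℤ} {P : PontSeq r}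
    (hP : P ∈ PT r (k + 1) l1 rg) {p : Fin k → (Fin (r + 1) → ℤ) × (Fin (r + 1) → ℤ)}
    (hp : ∀ i : Fin k, p i ∈ nestedPairs (P.lam (i + 2)) (P.rho (i + 1))) :
    splice P p ∈ above r (k + 1) l1 rg P := by
  obtain ⟨⟨hanti, hsub, hstep, hzero⟩, rfl, rfl⟩ := hP
  have hp (i) := mem_nestedPairs.1 (hp i)
  have hlam (n : ℕ) (h1 : 1 ≤ n) (h2 : n ≤ k + 1) :
      P.lam n ≤ (splice P p).lam n ∧ Antitone ((splice P p).lam n) := by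
    by_cases h : 2 ≤ n
    · obtain ⟨m, rfl⟩ := Nat.exists_eq_add_of_le' h
      have := splice_lam P p ⟨m, by lia⟩
      simp only at this
      rw [this]
      exact ⟨(hp ⟨m, by lia⟩).1, (hp ⟨m, by lia⟩).2.2.2.1⟩
    · simp only [splice, h, false_and, dite_false]
      exact ⟨le_rfl, (hanti n h1 h2).1⟩
  have hrho (n : ℕ) (h1 : 1 ≤ n) (h2 : n ≤ k + 1) :
      (splice P p).rho n ≤ P.rho n ∧ Antitone ((splice P p).rho n) := by
    by_cases h : n ≤ k
    · obtain ⟨m, rfl⟩ := Nat.exists_eq_add_of_le' h1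
      have := splice_rho P p ⟨m, by lia⟩
      simp only at this
      rw [this]
      exact ⟨(hp ⟨m, by lia⟩).2.2.1, (hp ⟨m, by lia⟩).2.2.2.2⟩
    · simp only [splice, h, and_false, dite_false]
      exact ⟨le_rfl, (hanti n h1 h2).2⟩
  have hmid (n : ℕ) (h1 : 1 ≤ n) (h2 : n + 1 ≤ k + 1) :
      (splice P p).lam (n + 1) ≤ (splice P p).rho n := by
    obtain ⟨m, rfl⟩ := Nat.exists_eq_add_of_le' h1
    have e1 := splice_lam P p ⟨m, by lia⟩
    have e2 := splice_rho P p ⟨m, by lia⟩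
    simp only at e1 e2
    rw [e2, show m + 1 + 1 = m + 2 from rfl, e1]
    exact (hp ⟨m, by lia⟩).2.1
  refine ⟨⟨⟨?_, ?_, ?_, ?_⟩, ?_, ?_⟩, ?_⟩
  · exact fun n h1 h2 => ⟨(hlam n h1 h2).2, (hrho n h1 h2).2⟩
  · exact fun n h1 h2 => boxes_subset_iff.2 (hmid n h1 h2)
  · exact fun n h1 h2 =>
      Step.mono (hstep n h1 h2) (hlam n h1 h2).1 (hrho n h1 h2).1
  · intro n hn
    have h1 : ¬ (2 ≤ n ∧ n ≤ k + 1) := by lia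
    have h2 : ¬ (1 ≤ n ∧ n ≤ k) := by lia
    simpa only [splice, h1, h2, dite_false] using hzero n hn
  · simp [splice]
  · simp [splice]
  · exact fun n h1 h2 => ⟨boxes_subset_iff.2 (hlam (n + 1) (by lia) h2).1,
      boxes_subset_iff.2 (hmid n h1 h2), boxes_subset_iff.2 (hrho n h1 (by lia)).1⟩

lemma bijOn_splice {r k : ℕ} {l1 rg : Fin (r + 1) → ℤ} {P : PontSeq r}
    (hP : P ∈ PT r (k + 1) l1 rg) :
    Set.BijOn (splice (k := k) P) ↑(Fintype.piFinset fun i : Fin k =>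
      nestedPairs (P.lam (i + 2)) (P.rho (i + 1))) (above r (k + 1) l1 rg P) := by
  refine ⟨fun p hp => splice_mem_above hP (Fintype.mem_piFinset.1 hp), fun p _ q _ h => ?_, ?_⟩
  · funext i
    refine Prod.ext ?_ ?_
    · rw [← splice_lam P p, h, splice_lam]
    · rw [← splice_rho P p, h, splice_rho]
  · rintro Q ⟨⟨⟨hanti, hsub, hstep, hzero⟩, rfl, rfl⟩, hQ⟩
    refine ⟨fun i => (Q.lam (i + 2), Q.rho (i + 1)), ?_, ?_⟩
    · refine Fintype.mem_piFinset.2 fun i => mem_nestedPairs.2 ?_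
      have h := hQ (i + 1) (by lia) (by lia)
      exact ⟨boxes_subset_iff.1 h.1, boxes_subset_iff.1 h.2.1, boxes_subset_iff.1 h.2.2,
        (hanti (i + 2) (by lia) (by lia)).1, (hanti (i + 1) (by lia) (by lia)).2⟩
    · refine PontSeq.ext' (fun n => ?_) fun n => ?_
      · by_cases h : 2 ≤ n ∧ n ≤ k + 1
        · simp only [splice, h, and_self, dite_true]
          congr 1
          lia
        · simp only [splice, h, dite_false]
          by_cases h1 : n = 1
          · rw [h1, hP.2.1]
          · rw [(hP.1.2.2.2 n (by lia)).1, (hzero n (by lia)).1]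
      · by_cases h : 1 ≤ n ∧ n ≤ k
        · simp only [splice, h, and_self, dite_true]
          congr 1
          lia
        · simp only [splice, h, dite_false]
          by_cases h1 : n = k + 1
          · rw [h1, hP.2.2]
          · rw [(hP.1.2.2.2 n (by lia)).2, (hzero n (by lia)).2]

lemma finsum_mu_above {r k : ℕ} {l1 rg : Fin (r + 1) → ℤ} {P : PontSeq r}
    (hP : P ∈ PT r (k + 1) l1 rg) :
    ∑ᶠ Q ∈ above r (k + 1) l1 rg P, mu r (k + 1) Q = 1 := by
  rw [← finsum_mem_eq_of_bijOn (splice (k := k) P) (bijOn_splice hP)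
    (f := fun p => ∏ i : Fin k, weight r (p i).1 (p i).2), finsum_mem_coe_finset,
    ← Finset.prod_univ_sum (fun i : Fin k => nestedPairs (P.lam (i + 2)) (P.rho (i + 1)))
      (fun _ q => weight r q.1 q.2)]
  · refine Finset.prod_eq_one fun i _ => sum_weight_nestedPairs ?_ ?_
    · exact (hP.1.1 (i + 2) (by lia) (by lia)).1
    · exact boxes_subset_iff.1 (hP.1.2.1 (i + 1) (by lia) (by lia))
  · intro p _
    simp only [mu_eq_prod, splice_lam, splice_rho]

end Pont

open Pont in
/-- **Lemma.**  Fix `r ≥ 0`, `g ≥ 1` and nonincreasing `(r+1)`-tuples `λ¹, ρᵍ`.  The poset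
`PT(λ¹, ρᵍ)` (ordered by `Q ⊇ P` iff `λ^{n+1} ⊆ Q.λ^{n+1} ⊆ Q.ρ^n ⊆ ρ^n` for all
`1 ≤ n ≤ g−1`) is finite, and the combinatorial value `μ(P)` is its Möbius function:
for every `P ∈ PT(λ¹,ρᵍ)`, `∑_{Q ⊇ P} μ(Q) = 1`. -/
theorem stmt_2 (r g : ℕ) (hg : 1 ≤ g) (l1 rg : Fin (r + 1) → ℤ)
    (hl1 : Antitone l1) (hrg : Antitone rg) :
    (PT r g l1 rg).Finite ∧
    ∀ P ∈ PT r g l1 rg,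
      (∑ᶠ Q ∈ {Q : PontSeq r | Q ∈ PT r g l1 rg ∧ ∀ n, 1 ≤ n → n + 1 ≤ g →
          boxes r (P.lam (n + 1)) ⊆ boxes r (Q.lam (n + 1)) ∧
          boxes r (Q.lam (n + 1)) ⊆ boxes r (Q.rho n) ∧
          boxes r (Q.rho n) ⊆ boxes r (P.rho n)},
        mu r g Q) = 1 := by
  obtain ⟨k, rfl⟩ := Nat.exists_eq_add_of_le' hg
  exact ⟨finite_PT r (k + 1) l1 rg, fun P hP => finsum_mu_above hP⟩
end

section
/- Let d ≥ 1 and let ω = (d−1, d−2, …, 0) ∈ S_d be the descending permutation. For τ ∈ S_d, the pair (ω, τ) is coherent if and only if τ is the identity permutation (0,1,…,d−1). -/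
namespace Coh

/-- The first `k` values `(σ_0, …, σ_{k−1})` of a permutation of `Fin d`, sorted
increasingly. -/
def sortedFirst (d : ℕ) (σ : Equiv.Perm (Fin d)) (k : ℕ) : List ℕ :=
  List.insertionSort (· ≤ ·) (((List.finRange d).take k).map fun i => (σ i : ℕ))

/-- `(σ,τ)` is `k`-coherent: with `s`, `t` the increasing rearrangements of the first `k`
values of `σ`, `τ`, one has `s_i + t_{k−1−i} < d` for all `0 ≤ i ≤ k−1`. -/
def KCoherent (d : ℕ) (σ τ : Equiv.Perm (Fin d)) (k : ℕ) : Prop :=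
  ∀ i : ℕ, i < k →
    (sortedFirst d σ k).getD i 0 + (sortedFirst d τ k).getD (k - 1 - i) 0 < d

/-- `(σ,τ)` is coherent: it is `k`-coherent for all `k = 1, …, d`. -/
def Coherent (d : ℕ) (σ τ : Equiv.Perm (Fin d)) : Prop :=
  ∀ k : ℕ, 1 ≤ k → k ≤ d → KCoherent d σ τ k

/-- A move on a pair of permutations: if `σ_i < σ_{i+1}` exchange `τ_i` and `τ_{i+1}`,
or if `τ_i < τ_{i+1}` exchange `σ_i` and `σ_{i+1}`. -/
def IsMove (d : ℕ) (p q : Equiv.Perm (Fin d) × Equiv.Perm (Fin d)) : Prop :=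
  ∃ i : ℕ, ∃ h : i + 1 < d,
    (p.1 ⟨i, by omega⟩ < p.1 ⟨i + 1, h⟩ ∧
      q = (p.1, p.2 * Equiv.swap ⟨i, by omega⟩ ⟨i + 1, h⟩)) ∨
    (p.2 ⟨i, by omega⟩ < p.2 ⟨i + 1, h⟩ ∧
      q = (p.1 * Equiv.swap ⟨i, by omega⟩ ⟨i + 1, h⟩, p.2))

end Coh

namespace Coh

lemma map_take_finRange {d k : ℕ} (hk : k ≤ d) (σ : Equiv.Perm (Fin d)) (f : ℕ → ℕ)
    (hf : ∀ i : Fin d, (σ i : ℕ) = f i) :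
    (((List.finRange d).take k).map fun i => (σ i : ℕ)) = (List.range k).map f := by
  apply List.ext_getElem
  · simp [hk]
  · intro i h₁ h₂
    simp [hf]

/-- If the first `k` values of `σ` are a rearrangement of an increasing sequence `g`,
then sorting them gives `g`. -/
lemma sortedFirst_eq_of_perm {d k : ℕ} (σ : Equiv.Perm (Fin d)) (l : List ℕ)
    (hl : l.Pairwise (· ≤ ·))
    (h : (((List.finRange d).take k).map fun i => (σ i : ℕ)).Perm l) :
    sortedFirst d σ k = l :=
  List.Perm.eq_of_pairwise (le := (· ≤ ·)) (fun _ _ _ _ h₁ h₂ => le_antisymm h₁ h₂)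
    (List.pairwise_insertionSort _ _) hl ((List.perm_insertionSort _ _).trans h)

lemma sortedFirst_one {d k : ℕ} (hk : k ≤ d) : sortedFirst d 1 k = List.range k := by
  refine sortedFirst_eq_of_perm _ _ List.pairwise_le_range ?_
  rw [map_take_finRange hk 1 id fun _ => rfl, List.map_id]

lemma sortedFirst_descending {d k : ℕ} (hk : k ≤ d) (ω : Equiv.Perm (Fin d))
    (hω : ∀ i : Fin d, (ω i : ℕ) = d - 1 - (i : ℕ)) :
    sortedFirst d ω k = (List.range k).map (d - k + ·) := by
  apply sortedFirst_eq_of_perm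
  · exact List.pairwise_map.2 (List.pairwise_le_range.imp fun h => Nat.add_le_add_left h _)
  · rw [map_take_finRange hk ω (d - 1 - ·) hω]
    have h : (List.range k).map (d - 1 - ·) = ((List.range k).map (d - k + ·)).reverse := by
      apply List.ext_getElem
      · simp
      · intro i h₁ h₂
        simp at h₁ ⊢
        omega
    rw [h]
    exact List.reverse_perm _

lemma length_sortedFirst {d k : ℕ} (hk : k ≤ d) (σ : Equiv.Perm (Fin d)) :
    (sortedFirst d σ k).length = k := by
  simp [sortedFirst, hk]

lemma le_getD_sortedFirst {d k : ℕ} (hk : k ≤ d) (σ : Equiv.Perm (Fin d)) (j : Fin d)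
    (hj : (j : ℕ) < k) : (σ j : ℕ) ≤ (sortedFirst d σ k).getD (k - 1) 0 := by
  have hlen := length_sortedFirst hk σ
  have hmem : (σ j : ℕ) ∈ sortedFirst d σ k := by
    rw [sortedFirst, List.mem_insertionSort]
    refine List.mem_map.2 ⟨j, ?_, rfl⟩
    exact List.mem_iff_getElem.2 ⟨j, by simp [hj], by simp⟩
  obtain ⟨m, hm, hmj⟩ := List.mem_iff_getElem.1 hmem
  have hs : (sortedFirst d σ k).Pairwise (· ≤ ·) := List.pairwise_insertionSort _ _
  rw [← hmj, List.getD_eq_getElem _ _ (by omega)]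
  rcases (show m ≤ k - 1 by omega).eq_or_lt with h | h
  · simp [h]
  · exact List.pairwise_iff_getElem.1 hs _ _ _ _ h

lemma perm_eq_one_of_le {d : ℕ} (τ : Equiv.Perm (Fin d)) (h : ∀ j, τ j ≤ j) : τ = 1 := by
  ext j
  induction j using WellFoundedLT.induction with
  | ind j ih =>
    rcases (h j).lt_or_eq with hlt | heq
    · exact congrArg Fin.val (τ.injective (Fin.ext (ih _ hlt)))
    · simp [heq]

end Coh

open Coh in
/-- **Example.**  Let `ω = (d−1, …, 1, 0)` be the descending permutation.  Then `(ω, τ)`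
is coherent iff `τ` is the identity. -/
theorem stmt_8 (d : ℕ) (hd : 1 ≤ d) (ω τ : Equiv.Perm (Fin d))
    (hω : ∀ i : Fin d, (ω i : ℕ) = d - 1 - (i : ℕ)) :
    Coherent d ω τ ↔ τ = 1 := by
  constructor
  · intro h
    refine perm_eq_one_of_le τ fun j => ?_
    have hj : (j : ℕ) + 1 ≤ d := j.isLt
    have h₀ := h (j + 1) (by omega) hj 0 (by omega)
    rw [sortedFirst_descending hj ω hω, List.getD_eq_getElem _ _ (by simp)] at h₀
    have h₁ := le_getD_sortedFirst hj τ j (by omega)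
    simp only [List.getElem_map, List.getElem_range, Nat.sub_zero] at h₀
    rw [Fin.le_def]
    omega
  · rintro rfl k hk₁ hk i hi
    rw [sortedFirst_descending hk ω hω, sortedFirst_one hk,
      List.getD_eq_getElem _ _ (by simpa using hi),
      List.getD_eq_getElem _ _ (by simp; omega)]
    simp only [List.getElem_map, List.getElem_range]
    omega
end
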